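/- arXiv:2205.10702 — 3 statements merged into one kernel-verified Lean document; each statement's English description precedes it below -/
import Mathlib

section
/- For every positive integer M, define A = ∑_{m=1}^{M} ∑_{n=1}^{M} ((m−1)² − (n−1)²)², B = ∑_{m=1}^{M} ∑_{n=1}^{M} ((m−1)² − (n−1)²)(m−n), and C = ∑_{m=1}^{M} ∑_{n=1}^{M} (m−n)². Then A·C − B² = M⁴(M² − 1)²(M² − 4)/540. In particular A·C − B² > 0 if and only if M ≥ 3. -/
open Finset

/-- The double sum of products of differences, in terms of single sums. -/
theorem sum_sum_sub_mul_sub {ι R : Type*} [CommRing R] (s : Finset ι) (f g : ι → R) :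
    ∑ m ∈ s, ∑ n ∈ s, (f m - f n) * (g m - g n) =
      2 * ((#s : R) * ∑ m ∈ s, f m * g m - (∑ m ∈ s, f m) * ∑ m ∈ s, g m) := by
  simp only [sub_mul, mul_sub, sum_sub_distrib, sum_const, nsmul_eq_mul, ← mul_sum, ← sum_mul]
  ring

theorem sum_Icc_sub_one (M : ℕ) :
    ∑ m ∈ Icc 1 M, ((m : ℝ) - 1) = M * (M - 1) / 2 := by
  induction M with
  | zero => simp
  | succ k ih => rw [sum_Icc_succ_top (by omega), ih]; push_cast; ring

theorem sum_Icc_sub_one_pow_two (M : ℕ) :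
    ∑ m ∈ Icc 1 M, ((m : ℝ) - 1) ^ 2 = (M : ℝ) * (M - 1) * (2 * M - 1) / 6 := by
  induction M with
  | zero => simp
  | succ k ih => rw [sum_Icc_succ_top (by omega), ih]; push_cast; ring

theorem sum_Icc_sub_one_pow_three (M : ℕ) :
    ∑ m ∈ Icc 1 M, ((m : ℝ) - 1) ^ 3 = (M : ℝ) ^ 2 * (M - 1) ^ 2 / 4 := by
  induction M with
  | zero => simp
  | succ k ih => rw [sum_Icc_succ_top (by omega), ih]; push_cast; ring

theorem sum_Icc_sub_one_pow_four (M : ℕ) :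
    ∑ m ∈ Icc 1 M, ((m : ℝ) - 1) ^ 4 =
      M * (M - 1) * (2 * M - 1) * (3 * (M : ℝ) ^ 2 - 3 * M - 1) / 30 := by
  induction M with
  | zero => simp
  | succ k ih => rw [sum_Icc_succ_top (by omega), ih]; push_cast; ring

theorem sum_sum_sq_sub_sq_sq (M : ℕ) :
    ∑ m ∈ Icc 1 M, ∑ n ∈ Icc 1 M, (((m : ℝ) - 1) ^ 2 - ((n : ℝ) - 1) ^ 2) ^ 2 =
      (M : ℝ) ^ 2 * ((M : ℝ) ^ 2 - 1) * (2 * M - 1) * (8 * M - 11) / 90 := by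
  have h := sum_sum_sub_mul_sub (Icc 1 M) (fun m : ℕ => ((m : ℝ) - 1) ^ 2)
    (fun m : ℕ => ((m : ℝ) - 1) ^ 2)
  simp only [← pow_two, ← pow_mul, Nat.reducePow, sum_Icc_sub_one_pow_four,
    sum_Icc_sub_one_pow_two, Nat.card_Icc, add_tsub_cancel_right] at h
  rw [h]
  ring

theorem sum_sum_sq_sub_sq_mul_sub (M : ℕ) :
    ∑ m ∈ Icc 1 M, ∑ n ∈ Icc 1 M,
        (((m : ℝ) - 1) ^ 2 - ((n : ℝ) - 1) ^ 2) * ((m : ℝ) - (n : ℝ)) =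
      (M : ℝ) ^ 2 * ((M : ℝ) ^ 2 - 1) * (M - 1) / 6 := by
  have h := sum_sum_sub_mul_sub (Icc 1 M) (fun m : ℕ => ((m : ℝ) - 1) ^ 2)
    (fun m : ℕ => (m : ℝ) - 1)
  simp only [sub_sub_sub_cancel_right, ← pow_succ, Nat.reduceAdd, sum_Icc_sub_one_pow_three,
    sum_Icc_sub_one_pow_two, sum_Icc_sub_one, Nat.card_Icc, add_tsub_cancel_right] at h
  rw [h]
  ring

theorem sum_sum_sub_sq (M : ℕ) :
    ∑ m ∈ Icc 1 M, ∑ n ∈ Icc 1 M, ((m : ℝ) - (n : ℝ)) ^ 2 =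
      (M : ℝ) ^ 2 * ((M : ℝ) ^ 2 - 1) / 6 := by
  have h := sum_sum_sub_mul_sub (Icc 1 M) (fun m : ℕ => (m : ℝ) - 1) (fun m : ℕ => (m : ℝ) - 1)
  simp only [sub_sub_sub_cancel_right, ← pow_two, sum_Icc_sub_one_pow_two, sum_Icc_sub_one,
    Nat.card_Icc, add_tsub_cancel_right] at h
  rw [h]
  ring

/-- Discriminant identity at the core of Corollary 1: with
`A = ∑∑ ((m−1)² − (n−1)²)²`, `B = ∑∑ ((m−1)² − (n−1)²)(m−n)`, `C = ∑∑ (m−n)²`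
(all double sums over `m, n = 1, …, M`), one has
`A·C − B² = M⁴(M² − 1)²(M² − 4)/540`; in particular `A·C − B² > 0 ↔ M ≥ 3`. -/
theorem double_sum_discriminant (M : ℕ) (hM : 0 < M) :
    (∑ m ∈ Icc 1 M, ∑ n ∈ Icc 1 M, (((m : ℝ) - 1) ^ 2 - ((n : ℝ) - 1) ^ 2) ^ 2) *
        (∑ m ∈ Icc 1 M, ∑ n ∈ Icc 1 M, ((m : ℝ) - (n : ℝ)) ^ 2) -
      (∑ m ∈ Icc 1 M, ∑ n ∈ Icc 1 M,
          (((m : ℝ) - 1) ^ 2 - ((n : ℝ) - 1) ^ 2) * ((m : ℝ) - (n : ℝ))) ^ 2 =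
      (M : ℝ) ^ 4 * ((M : ℝ) ^ 2 - 1) ^ 2 * ((M : ℝ) ^ 2 - 4) / 540 ∧
    (0 <
      (∑ m ∈ Icc 1 M, ∑ n ∈ Icc 1 M, (((m : ℝ) - 1) ^ 2 - ((n : ℝ) - 1) ^ 2) ^ 2) *
          (∑ m ∈ Icc 1 M, ∑ n ∈ Icc 1 M, ((m : ℝ) - (n : ℝ)) ^ 2) -
        (∑ m ∈ Icc 1 M, ∑ n ∈ Icc 1 M,
            (((m : ℝ) - 1) ^ 2 - ((n : ℝ) - 1) ^ 2) * ((m : ℝ) - (n : ℝ))) ^ 2 ↔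
      3 ≤ M) := by
  have key : ∀ x : ℝ, x ^ 2 * (x ^ 2 - 1) * (2 * x - 1) * (8 * x - 11) / 90 *
      (x ^ 2 * (x ^ 2 - 1) / 6) - (x ^ 2 * (x ^ 2 - 1) * (x - 1) / 6) ^ 2 =
      x ^ 4 * (x ^ 2 - 1) ^ 2 * (x ^ 2 - 4) / 540 := fun x => by ring
  rw [sum_sum_sq_sub_sq_sq, sum_sum_sq_sub_sq_mul_sub, sum_sum_sub_sq, key]
  refine ⟨rfl, fun h => ?_, fun h => ?_⟩
  · by_contra! hlt
    interval_cases M <;> norm_num at h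
  · have h3 : (3 : ℝ) ≤ M := by exact_mod_cast h
    have h1 : 0 < (M : ℝ) ^ 2 - 1 := by nlinarith
    have h4 : 0 < (M : ℝ) ^ 2 - 4 := by nlinarith
    positivity
end

section
/- Let M ≥ 2 be an integer, let c, f_c, d be positive reals and θ_D a real with cos θ_D ≠ 0. For a sequence ξ : {1,…,M} → ℝ define X(ξ) = (2π²/c²)·∑_{m=1}^{M}∑_{n=1}^{M} (2(ξ_m − ξ_n))², Y(ξ) = (4π²·d·f_c·cos θ_D/c²)·∑_{m=1}^{M}∑_{n=1}^{M} 2(ξ_m − ξ_n)(m−n), and Z = (8π²·f_c²·d²·cos²θ_D/c²)·∑_{m=1}^{M}∑_{n=1}^{M} (m−n)². Let η : {1,…,M} → ℝ satisfy X(η)·Z − Y(η)² > 0 and let κ be a nonzero real. Then for the scaled sequence ξ = κ·η: (i) X(ξ)·Z − Y(ξ)² = κ²·(X(η)·Z − Y(η)²) > 0; (ii) 2√(M²Z/(X(ξ)Z − Y(ξ)²)) = (1/|κ|)·2√(M²Z/(X(η)Z − Y(η)²)); and (iii) 2√(M²X(ξ)/(X(ξ)Z − Y(ξ)²)) = 2√(M²X(η)/(X(η)Z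 − Y(η)²)). -/
open Real Finset

/-- Coefficient `X` of the half-power boundary quadratic form of Lemma 1, as a
function of the effective offset sequence `ξ`. -/
noncomputable def coefX (c : ℝ) (M : ℕ) (ξ : ℕ → ℝ) : ℝ :=
  (2 * π ^ 2 / c ^ 2) * ∑ m ∈ Icc 1 M, ∑ n ∈ Icc 1 M, (2 * (ξ m - ξ n)) ^ 2

/-- Coefficient `Y` of the half-power boundary quadratic form of Lemma 1, as a
function of the effective offset sequence `ξ`. -/
noncomputable def coefY (c d f_c θ_D : ℝ) (M : ℕ) (ξ : ℕ → ℝ) : ℝ :=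
  (4 * π ^ 2 * d * f_c * Real.cos θ_D / c ^ 2) *
    ∑ m ∈ Icc 1 M, ∑ n ∈ Icc 1 M, 2 * (ξ m - ξ n) * ((m : ℝ) - (n : ℝ))

/-- Coefficient `Z` of the half-power boundary quadratic form of Lemma 1. -/
noncomputable def coefZ (c d f_c θ_D : ℝ) (M : ℕ) : ℝ :=
  (8 * π ^ 2 * f_c ^ 2 * d ^ 2 * Real.cos θ_D ^ 2 / c ^ 2) *
    ∑ m ∈ Icc 1 M, ∑ n ∈ Icc 1 M, ((m : ℝ) - (n : ℝ)) ^ 2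

theorem coefX_const_mul (c : ℝ) (M : ℕ) (η : ℕ → ℝ) (κ : ℝ) :
    coefX c M (fun m => κ * η m) = κ ^ 2 * coefX c M η := by
  simp only [coefX, Finset.mul_sum]
  exact sum_congr rfl fun m _ => sum_congr rfl fun n _ => by ring

theorem coefY_const_mul (c d f_c θ_D : ℝ) (M : ℕ) (η : ℕ → ℝ) (κ : ℝ) :
    coefY c d f_c θ_D M (fun m => κ * η m) = κ * coefY c d f_c θ_D M η := by
  simp only [coefY, Finset.mul_sum]
  exact sum_congr rfl fun m _ => sum_congr rfl fun n _ => by ring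

/-- Scaling lemma behind Propositions 1 and 2: scaling the effective offset
sequence `η` by a nonzero factor `κ` (i) scales the discriminant `XZ − Y²` by `κ²`
(keeping it positive), (ii) scales the range-dimension beamwidth
`2√(M²Z/(XZ − Y²))` by `1/|κ|`, and (iii) leaves the angular-dimension beamwidth
`2√(M²X/(XZ − Y²))` unchanged. -/
theorem scaled_offsets_beamwidths (M : ℕ) (hM : 2 ≤ M) (c f_c d θ_D : ℝ)
    (hc : 0 < c) (hf : 0 < f_c) (hd : 0 < d) (hθ : Real.cos θ_D ≠ 0)
    (η : ℕ → ℝ) (κ : ℝ) (hκ : κ ≠ 0)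
    (hpos : 0 < coefX c M η * coefZ c d f_c θ_D M - coefY c d f_c θ_D M η ^ 2) :
    (coefX c M (fun m => κ * η m) * coefZ c d f_c θ_D M -
          coefY c d f_c θ_D M (fun m => κ * η m) ^ 2 =
        κ ^ 2 * (coefX c M η * coefZ c d f_c θ_D M - coefY c d f_c θ_D M η ^ 2) ∧
      0 < coefX c M (fun m => κ * η m) * coefZ c d f_c θ_D M -
          coefY c d f_c θ_D M (fun m => κ * η m) ^ 2) ∧
    2 * Real.sqrt ((M : ℝ) ^ 2 * coefZ c d f_c θ_D M /
        (coefX c M (fun m => κ * η m) * coefZ c d f_c θ_D M -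
          coefY c d f_c θ_D M (fun m => κ * η m) ^ 2)) =
      (1 / |κ|) * (2 * Real.sqrt ((M : ℝ) ^ 2 * coefZ c d f_c θ_D M /
        (coefX c M η * coefZ c d f_c θ_D M - coefY c d f_c θ_D M η ^ 2))) ∧
    2 * Real.sqrt ((M : ℝ) ^ 2 * coefX c M (fun m => κ * η m) /
        (coefX c M (fun m => κ * η m) * coefZ c d f_c θ_D M -
          coefY c d f_c θ_D M (fun m => κ * η m) ^ 2)) =
      2 * Real.sqrt ((M : ℝ) ^ 2 * coefX c M η /
        (coefX c M η * coefZ c d f_c θ_D M - coefY c d f_c θ_D M η ^ 2)) := by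
  have hdisc : coefX c M (fun m => κ * η m) * coefZ c d f_c θ_D M -
        coefY c d f_c θ_D M (fun m => κ * η m) ^ 2 =
      κ ^ 2 * (coefX c M η * coefZ c d f_c θ_D M - coefY c d f_c θ_D M η ^ 2) := by
    rw [coefX_const_mul, coefY_const_mul]
    ring
  have hκ2 : 0 < κ ^ 2 := by positivity
  rw [hdisc]
  refine ⟨⟨rfl, mul_pos hκ2 hpos⟩, ?_, ?_⟩
  · rw [mul_comm (κ ^ 2), ← div_div, Real.sqrt_div' _ hκ2.le, Real.sqrt_sq_eq_abs]
    ring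
  · rw [coefX_const_mul, mul_left_comm, mul_div_mul_left _ _ hκ2.ne']
end

section
/- Let M be a positive integer, let c, f_c, d, R_D be positive reals and θ_D a real with cos θ_D ≠ 0. Given frequency offsets Δf : {1,…,M} → ℝ, set ξ_m = Δf_m − (d²·f_c/(2R_D²))·(m−1)², and define X = (2π²/c²)·∑_{m=1}^{M}∑_{n=1}^{M} (2(ξ_m − ξ_n))², Y = (4π²·d·f_c·cos θ_D/c²)·∑_{m=1}^{M}∑_{n=1}^{M} 2(ξ_m − ξ_n)(m−n), Z = (8π²·f_c²·d²·cos²θ_D/c²)·∑_{m=1}^{M}∑_{n=1}^{M} (m−n)². Then XZ > Y² if and only if there do NOT exist real constants β and C such that Δf_m = β·m/2 + (f_c·d²/(2R_D²))·(m−1)² + C for all m = 1,…,M. -/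
open Real Finset

/-- Equality case of the Cauchy–Schwarz inequality for finite sums. -/
theorem mul_eq_mul_of_sum_sq_mul_sum_sq_le {ι : Type*} {s : Finset ι} {u v : ι → ℝ}
    (h : (∑ i ∈ s, u i ^ 2) * ∑ i ∈ s, v i ^ 2 ≤ (∑ i ∈ s, u i * v i) ^ 2) {i : ι} (hi : i ∈ s) :
    (∑ j ∈ s, v j ^ 2) * u i = (∑ j ∈ s, u j * v j) * v i := by
  set P := ∑ j ∈ s, u j ^ 2
  set Q := ∑ j ∈ s, u j * v j
  set R := ∑ j ∈ s, v j ^ 2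
  have key : ∑ j ∈ s, (R * u j - Q * v j) ^ 2 = R * (P * R - Q ^ 2) := by
    calc ∑ j ∈ s, (R * u j - Q * v j) ^ 2
        = ∑ j ∈ s, (R ^ 2 * u j ^ 2 - 2 * R * Q * (u j * v j) + Q ^ 2 * v j ^ 2) :=
          sum_congr rfl fun j _ => by ring
      _ = R ^ 2 * P - 2 * R * Q * Q + Q ^ 2 * R := by
          rw [sum_add_distrib, sum_sub_distrib, ← mul_sum, ← mul_sum, ← mul_sum]
      _ = R * (P * R - Q ^ 2) := by ring
  have hR : 0 ≤ R := sum_nonneg fun j _ => sq_nonneg _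
  have hle : (R * u i - Q * v i) ^ 2 ≤ 0 :=
    (single_le_sum (fun j _ => sq_nonneg (R * u j - Q * v j)) hi).trans
      (key.trans_le (mul_nonpos_of_nonneg_of_nonpos hR (sub_nonpos.2 h)))
  exact sub_eq_zero.1 (pow_eq_zero_iff two_ne_zero |>.1 (le_antisymm hle (sq_nonneg _)))

/-- Strict Cauchy–Schwarz for pairwise differences: it fails exactly when `f` is an affine function
of the injective function `g`. -/
theorem sum_sub_mul_sub_sq_lt_iff {ι : Type*} {s : Finset ι} {f g : ι → ℝ}
    (hg : Set.InjOn g s) :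
    (∑ i ∈ s, ∑ j ∈ s, (f i - f j) * (g i - g j)) ^ 2 <
        (∑ i ∈ s, ∑ j ∈ s, (f i - f j) ^ 2) * ∑ i ∈ s, ∑ j ∈ s, (g i - g j) ^ 2 ↔
      ¬ ∃ a b : ℝ, ∀ i ∈ s, f i = a * g i + b := by
  rw [← not_le, not_iff_not]
  constructor
  · intro h
    obtain rfl | ⟨k, hk⟩ := s.eq_empty_or_nonempty
    · simp
    simp only [← sum_product'] at h
    set R := ∑ p ∈ s ×ˢ s, (g p.1 - g p.2) ^ 2
    set Q := ∑ p ∈ s ×ˢ s, (f p.1 - f p.2) * (g p.1 - g p.2)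
    refine ⟨Q / R, f k - Q / R * g k, fun i hi => ?_⟩
    have hik : (i, k) ∈ s ×ˢ s := mk_mem_product hi hk
    have e : R * (f i - f k) = Q * (g i - g k) :=
      mul_eq_mul_of_sum_sq_mul_sum_sq_le (u := fun p : ι × ι => f p.1 - f p.2)
        (v := fun p : ι × ι => g p.1 - g p.2) h hik
    by_cases hR : R = 0
    · have h0 := (sum_eq_zero_iff_of_nonneg fun p _ => sq_nonneg (g p.1 - g p.2)).1 hR _ hik
      obtain rfl : i = k := hg hi hk (sub_eq_zero.1 (pow_eq_zero_iff two_ne_zero |>.1 h0))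
      ring
    · field_simp
      linarith
  · rintro ⟨a, b, h⟩
    have hsub : ∀ i ∈ s, ∀ j ∈ s, f i - f j = a * (g i - g j) := fun i hi j hj => by
      rw [h i hi, h j hj]; ring
    have hP : ∑ i ∈ s, ∑ j ∈ s, (f i - f j) ^ 2 = a ^ 2 * ∑ i ∈ s, ∑ j ∈ s, (g i - g j) ^ 2 := by
      simp only [mul_sum]
      exact sum_congr rfl fun i hi => sum_congr rfl fun j hj => by rw [hsub i hi j hj]; ring
    have hQ : ∑ i ∈ s, ∑ j ∈ s, (f i - f j) * (g i - g j) =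
        a * ∑ i ∈ s, ∑ j ∈ s, (g i - g j) ^ 2 := by
      simp only [mul_sum]
      exact sum_congr rfl fun i hi => sum_congr rfl fun j hj => by rw [hsub i hi j hj]; ring
    rw [hP, hQ]
    exact le_of_eq (by ring)

theorem coefX_mul_coefZ_sub_coefY_sq (c d f_c θ_D : ℝ) (M : ℕ) (ξ : ℕ → ℝ) :
    coefX c M ξ * coefZ c d f_c θ_D M - coefY c d f_c θ_D M ξ ^ 2 =
      (8 * π ^ 2 * d * f_c * Real.cos θ_D / c ^ 2) ^ 2 *
        ((∑ m ∈ Icc 1 M, ∑ n ∈ Icc 1 M, (ξ m - ξ n) ^ 2) *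
            ∑ m ∈ Icc 1 M, ∑ n ∈ Icc 1 M, ((m : ℝ) - (n : ℝ)) ^ 2 -
          (∑ m ∈ Icc 1 M, ∑ n ∈ Icc 1 M, (ξ m - ξ n) * ((m : ℝ) - (n : ℝ))) ^ 2) := by
  simp only [coefX, coefY, coefZ, mul_pow, mul_assoc (2 : ℝ), ← mul_sum]
  ring

/-- The ellipse condition (7) of the paper: with effective offsets
`ξ_m = Δf_m − (d²f_c/(2R_D²))(m−1)²`, the half-power boundary is an ellipse
(`XZ > Y²`) if and only if there do NOT exist constants `β, C` such that
`Δf_m = β·m/2 + (f_c d²/(2R_D²))·(m−1)² + C` for all `m = 1, …, M`. -/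
theorem ellipse_condition_iff_not_degenerate_offsets (M : ℕ) (hM : 0 < M)
    (c f_c d R_D θ_D : ℝ) (hc : 0 < c) (hf : 0 < f_c) (hd : 0 < d) (hR : 0 < R_D)
    (hθ : Real.cos θ_D ≠ 0) (Δf : ℕ → ℝ) :
    let ξ : ℕ → ℝ := fun m => Δf m - d ^ 2 * f_c / (2 * R_D ^ 2) * ((m : ℝ) - 1) ^ 2
    (coefY c d f_c θ_D M ξ ^ 2 < coefX c M ξ * coefZ c d f_c θ_D M ↔
      ¬ ∃ β C : ℝ, ∀ m ∈ Icc 1 M,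
        Δf m = β * (m : ℝ) / 2 + f_c * d ^ 2 / (2 * R_D ^ 2) * ((m : ℝ) - 1) ^ 2 + C) := by
  intro ξ
  have hK : 0 < (8 * π ^ 2 * d * f_c * Real.cos θ_D / c ^ 2) ^ 2 := by positivity
  rw [← sub_pos, coefX_mul_coefZ_sub_coefY_sq, mul_pos_iff_of_pos_left hK, sub_pos,
    sum_sub_mul_sub_sq_lt_iff (g := fun m : ℕ => (m : ℝ)) Nat.cast_injective.injOn, not_iff_not]
  constructor
  · rintro ⟨a, b, h⟩
    refine ⟨2 * a, b, fun m hm => ?_⟩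
    linear_combination h m hm
  · rintro ⟨β, C, h⟩
    refine ⟨β / 2, C, fun m hm => ?_⟩
    linear_combination h m hm
end
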